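/- Let p, q ∈ ℝ, let M be the 2×2 real matrix with rows (p, q) and (−q, p), let v_min > 0, let v₀ ∈ ℝ² (Euclidean) with V₀ := ‖v₀‖ ≥ v_min, and let v_δ ∈ ℝ². Define the ripple ratio ρ := ‖v_δ‖/V₀ and suppose 2ρ + ρ² < 1, and set v := v₀ + v_δ. Then v ≠ 0 and the nonlinear remainder of the constant power load current satisfies ‖(1/‖v‖²)·M v − (1/V₀²)·M v‖ ≤ (√(p² + q²)/v_min²) · ((1 + ρ)·(2 + ρ)/(1 − (2ρ + ρ²))) · ‖v_δ‖. -/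

import Mathlib

open Matrix

theorem cpl_norm_aux (p q : ℝ) (v : EuclideanSpace ℝ (Fin 2)) :
    ‖Matrix.toEuclideanLin (!![p, q; -q, p]) v‖ = Real.sqrt (p ^ 2 + q ^ 2) * ‖v‖ := by
  rw [EuclideanSpace.norm_eq, EuclideanSpace.norm_eq, ← Real.sqrt_mul (by positivity)]
  congr 1
  simp [Matrix.toLpLin_apply, Matrix.mulVec, dotProduct, Fin.sum_univ_two]
  ring

/-- Lemma 2 of the paper: the constant power load is `ε(ρ)`-frequency-preserving.
With `v = v₀ + v_δ`, `V₀ = ‖v₀‖ ≥ v_min`, ripple ratio `ρ = ‖v_δ‖/V₀` satisfying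
`2ρ + ρ² < 1`, the nonlinear remainder `i_har = M v/‖v‖² − M v/V₀²` satisfies
`‖i_har‖ ≤ (√(p²+q²)/v_min²) · (1+ρ)(2+ρ)/(1−(2ρ+ρ²)) · ‖v_δ‖`. -/
theorem cpl_frequency_preserving_bound (p q : ℝ) (vmin : ℝ) (hvmin : 0 < vmin)
    (v₀ vδ : EuclideanSpace ℝ (Fin 2)) (hv₀ : vmin ≤ ‖v₀‖)
    (hρ : 2 * (‖vδ‖ / ‖v₀‖) + (‖vδ‖ / ‖v₀‖) ^ 2 < 1) :
    v₀ + vδ ≠ 0 ∧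
    ‖(1 / ‖v₀ + vδ‖ ^ 2) • Matrix.toEuclideanLin (!![p, q; -q, p]) (v₀ + vδ) -
        (1 / ‖v₀‖ ^ 2) • Matrix.toEuclideanLin (!![p, q; -q, p]) (v₀ + vδ)‖ ≤
      (Real.sqrt (p ^ 2 + q ^ 2) / vmin ^ 2) *
        ((1 + ‖vδ‖ / ‖v₀‖) * (2 + ‖vδ‖ / ‖v₀‖) /
          (1 - (2 * (‖vδ‖ / ‖v₀‖) + (‖vδ‖ / ‖v₀‖) ^ 2))) * ‖vδ‖ := by
  have hA : 0 < ‖v₀‖ := lt_of_lt_of_le hvmin hv₀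
  have hN1 : ‖v₀ + vδ‖ ≤ ‖v₀‖ + ‖vδ‖ := norm_add_le _ _
  have hN2 : ‖v₀‖ ≤ ‖v₀ + vδ‖ + ‖vδ‖ := by
    simpa using norm_sub_le (v₀ + vδ) vδ
  have hN0 : 0 ≤ ‖v₀ + vδ‖ := norm_nonneg _
  rw [← sub_smul, norm_smul, cpl_norm_aux, ← norm_ne_zero_iff, Real.norm_eq_abs]
  have hs : 0 ≤ Real.sqrt (p ^ 2 + q ^ 2) := Real.sqrt_nonneg _
  generalize Real.sqrt (p ^ 2 + q ^ 2) = s at *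
  have hr : 0 ≤ ‖vδ‖ / ‖v₀‖ := by positivity
  have hD : ‖vδ‖ = ‖vδ‖ / ‖v₀‖ * ‖v₀‖ := by field_simp
  generalize ‖vδ‖ / ‖v₀‖ = r at *
  generalize ‖vδ‖ = D at *
  generalize ‖v₀ + vδ‖ = N at *
  generalize ‖v₀‖ = A at *
  subst hD
  have hk : 0 < 1 - (2 * r + r ^ 2) := by linarith
  have habs : |A ^ 2 - N ^ 2| ≤ r * (2 + r) * A ^ 2 := by
    have h1 : |A - N| ≤ r * A := abs_le.2 ⟨by linarith, by linarith⟩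
    have h2 : |A + N| ≤ (2 + r) * A := abs_le.2 ⟨by nlinarith, by linarith⟩
    calc |A ^ 2 - N ^ 2| = |A - N| * |A + N| := by rw [← abs_mul]; ring_nf
      _ ≤ (r * A) * ((2 + r) * A) := by gcongr
      _ = _ := by ring
  have hNsq : (1 - (2 * r + r ^ 2)) * A ^ 2 ≤ N ^ 2 := by
    have := (abs_le.1 habs).2
    linarith
  have hNpos : 0 < N ^ 2 := lt_of_lt_of_le (by positivity) hNsq
  have hN : N ≠ 0 := by
    rintro rfl
    simp at hNpos
  refine ⟨hN, ?_⟩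
  have e : 1 / N ^ 2 - 1 / A ^ 2 = (A ^ 2 - N ^ 2) / (N ^ 2 * A ^ 2) := by
    field_simp
  rw [e, abs_div, abs_of_pos (by positivity : 0 < N ^ 2 * A ^ 2)]
  calc |A ^ 2 - N ^ 2| / (N ^ 2 * A ^ 2) * (s * N)
      ≤ (r * (2 + r) * A ^ 2) / ((1 - (2 * r + r ^ 2)) * A ^ 2 * A ^ 2) * (s * (A + r * A)) := by
        gcongr
    _ = s / A ^ 2 * ((1 + r) * (2 + r) / (1 - (2 * r + r ^ 2))) * (r * A) := by
        have := hk.ne'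
        generalize 1 - (2 * r + r ^ 2) = k at *
        field_simp
    _ ≤ _ := by gcongr
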